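/- Let m, k₁, k₂ be integers with m ≥ 9 and 2 ≤ k₁ < k₁ + 1 < k₂ ≤ ⌊(m−1)/2⌋, and let f, g be the characteristic-type functions defined from the weight classes A, B, C, D. Then for every F ∈ {f, g, f+g, f−g} and all pairwise distinct vectors v₁, v₂, v₃ ∈ F₃^m satisfying v₁ + v₂ + v₃ = 0, one has Re(F̂(v₁)) + Re(F̂(v₂)) − 2·Re(F̂(v₃)) ≠ 3^m. -/

import Mathlib

open Finset

/-- `ζ₃ = e^{2πi/3}`, a primitive complex cube root of unity. -/
noncomputable def zeta3 : ℂ := Complex.exp (2 * Real.pi * Complex.I / 3)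

/-- `ζ₃^a` for `a ∈ F₃`. -/
noncomputable def chi (a : ZMod 3) : ℂ := zeta3 ^ a.val

/-- Standard inner product on `F₃^m`. -/
def dotp {m : ℕ} (w x : Fin m → ZMod 3) : ZMod 3 := ∑ i, w i * x i

/-- Walsh transform of `F : F₃^m → F₃`. -/
noncomputable def walsh {m : ℕ} (F : (Fin m → ZMod 3) → ZMod 3)
    (w : Fin m → ZMod 3) : ℂ :=
  ∑ x : Fin m → ZMod 3, chi (F x - dotp w x)

/-- Ternary Krawtchouk polynomial `K_t(x,m)`. -/
def Kraw (t x m : ℕ) : ℤ :=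
  ∑ j ∈ Finset.range (t + 1),
    (-1 : ℤ) ^ j * 2 ^ (t - j) * (x.choose j : ℤ) * ((m - x).choose (t - j) : ℤ)

/-- Lloyd polynomial `Ψ_k(x,m) = Σ_{t=0}^k K_t(x,m)`. -/
def Lloyd (k x m : ℕ) : ℤ := ∑ t ∈ Finset.range (k + 1), Kraw t x m

/-- `f(x) = 1` iff `x ∈ A ∪ C ∪ D`, i.e. `1 ≤ wt(x) ≤ k₂` and `wt(x) ≠ k₁`. -/
def ffun (m k₁ k₂ : ℕ) (x : Fin m → ZMod 3) : ZMod 3 :=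
  if 1 ≤ hammingNorm x ∧ hammingNorm x ≤ k₂ ∧ hammingNorm x ≠ k₁ then 1 else 0

/-- `g(x) = 1` on `B ∪ C` (i.e. `k₁ ≤ wt(x) ≤ k₂ - 1`), `g(x) = -1` on `D` (`wt(x) = k₂`). -/
def gfun (m k₁ k₂ : ℕ) (x : Fin m → ZMod 3) : ZMod 3 :=
  if k₁ ≤ hammingNorm x ∧ hammingNorm x ≤ k₂ - 1 then 1
  else if hammingNorm x = k₂ then -1 else 0

/-- The codeword `c(u,r,v)` of `C_{f,g}` for the specific `f = ffun`, `g = gfun`. -/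
def cw (m k₁ k₂ : ℕ) (u r : ZMod 3) (v : Fin m → ZMod 3) :
    {x : Fin m → ZMod 3 // x ≠ 0} → ZMod 3 :=
  fun x => u * ffun m k₁ k₂ x.1 + r * gfun m k₁ k₂ x.1 + dotp v x.1

/-- Hamming weight of the codeword `c(u,r,v)`. -/
def cwt (m k₁ k₂ : ℕ) (u r : ZMod 3) (v : Fin m → ZMod 3) : ℕ :=
  (Finset.univ.filter
    (fun x : {x : Fin m → ZMod 3 // x ≠ 0} => cw m k₁ k₂ u r v x ≠ 0)).card

lemma chi_re (a : ZMod 3) : (chi a).re = if a = 0 then 1 else -1 / 2 := by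
  have h : (2 * Real.pi * Complex.I / 3 : ℂ) = ((Real.pi - Real.pi / 3 : ℝ) : ℂ) * Complex.I := by
    push_cast; ring
  have hre : zeta3.re = -1 / 2 := by
    rw [zeta3, h, Complex.exp_ofReal_mul_I_re, Real.cos_pi_sub, Real.cos_pi_div_three]
    norm_num
  have him : zeta3.im ^ 2 = 3 / 4 := by
    rw [zeta3, h, Complex.exp_ofReal_mul_I_im, Real.sin_pi_sub, Real.sin_pi_div_three, div_pow,
      Real.sq_sqrt (by norm_num)]
    norm_num
  have hval : ∀ b : ZMod 3, b = 0 ∨ b = 1 ∨ b = 2 := by decide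
  rcases hval a with rfl | rfl | rfl
  · simp [chi]
  · have h1 : (1 : ZMod 3).val = 1 := rfl
    simp [chi, h1, hre]
  · have h2 : (2 : ZMod 3).val = 2 := rfl
    have hne : (2 : ZMod 3) ≠ 0 := by decide
    rw [chi, h2, pow_two, Complex.mul_re, hre, if_neg hne]
    linarith

lemma chi_re_neg (a : ZMod 3) : (chi (-a)).re = (chi a).re := by
  simp [chi_re]

lemma chi_re_sub_add_chi_re_add (a b : ZMod 3) :
    (chi (a - b)).re + (chi (a + b)).re = 2 * ((chi a).re * (chi b).re) := by
  simp only [chi_re]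
  have hval : ∀ c : ZMod 3, c = 0 ∨ c = 1 ∨ c = 2 := by decide
  rcases hval a with rfl | rfl | rfl <;> rcases hval b with rfl | rfl | rfl <;>
    simp (decide := true) <;> norm_num

lemma chi_re_add_shifts (a : ZMod 3) :
    (chi a).re + (chi (a + 1)).re + (chi (a + 2)).re = 0 := by
  simp only [chi_re]
  have hval : ∀ c : ZMod 3, c = 0 ∨ c = 1 ∨ c = 2 := by decide
  rcases hval a with rfl | rfl | rfl <;> simp (decide := true) <;> norm_num

lemma dotp_neg_right {m : ℕ} (w x : Fin m → ZMod 3) : dotp w (-x) = -dotp w x := by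
  simp [dotp]

lemma dotp_neg_left {m : ℕ} (w x : Fin m → ZMod 3) : dotp (-w) x = -dotp w x := by
  simp [dotp]

lemma dotp_zero_left {m : ℕ} (x : Fin m → ZMod 3) : dotp 0 x = 0 := by
  simp [dotp]

lemma dotp_add_right {m : ℕ} (w x y : Fin m → ZMod 3) :
    dotp w (x + y) = dotp w x + dotp w y := by
  simp [dotp, mul_add, Finset.sum_add_distrib]

lemma dotp_single {m : ℕ} (w : Fin m → ZMod 3) (i : Fin m) (a : ZMod 3) :
    dotp w (Pi.single i a) = w i * a := by
  simp [dotp, Pi.single_apply]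

/-- A nonzero vector has nonzero inner product with some vector of any prescribed positive
weight. -/
lemma exists_hammingNorm_eq_dotp_ne_zero {m t : ℕ} (ht : 1 ≤ t) (htm : t ≤ m)
    {w : Fin m → ZMod 3} (hw : w ≠ 0) :
    ∃ x : Fin m → ZMod 3, hammingNorm x = t ∧ dotp w x ≠ 0 := by
  obtain ⟨i, hi⟩ := Function.ne_iff.mp hw
  obtain ⟨J, hiJ, hJ⟩ := Finset.exists_superset_card_eq (s := {i}) (n := t)
    (by simpa using ht) (by simpa using htm)
  have hiJ : i ∈ J := by simpa using hiJ
  let x : Fin m → ZMod 3 := fun j => if j ∈ J then 1 else 0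
  have hx : hammingNorm x = t := by
    rw [← hJ, hammingNorm]
    congr 1
    ext j
    simp [x]
  have hx' : hammingNorm (x + Pi.single i 1) = t := by
    rw [← hJ, hammingNorm]
    congr 1
    ext j
    by_cases hj : j = i
    · subst hj
      simp [x, hiJ]
      decide
    · simp [x, hj]
  by_cases h : dotp w x = 0
  · refine ⟨_, hx', ?_⟩
    rw [dotp_add_right, dotp_single, h]
    simpa using hi
  · exact ⟨x, hx, h⟩

lemma sum_chi_re_dotp {m : ℕ} {w : Fin m → ZMod 3} (hw : w ≠ 0) :
    ∑ x : Fin m → ZMod 3, (chi (dotp w x)).re = 0 := by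
  obtain ⟨i, hi⟩ := Function.ne_iff.mp hw
  have hy (a : ZMod 3) : ∑ x : Fin m → ZMod 3, (chi (dotp w x)).re =
      ∑ x : Fin m → ZMod 3, (chi (dotp w x + a)).re := by
    rw [← Equiv.sum_comp (Equiv.addRight (Pi.single i ((w i)⁻¹ * a)))]
    refine Finset.sum_congr rfl fun x _ => ?_
    rw [Equiv.coe_addRight, dotp_add_right, dotp_single, mul_inv_cancel_left₀ hi]
  have h : ∑ x : Fin m → ZMod 3, ((chi (dotp w x)).re + (chi (dotp w x + 1)).re +
      (chi (dotp w x + 2)).re) = 0 :=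
    Finset.sum_eq_zero fun x _ => chi_re_add_shifts _
  rw [Finset.sum_add_distrib, Finset.sum_add_distrib, ← hy, ← hy] at h
  linarith

lemma sum_chi_re_dotp_eq_ite {m : ℕ} (w : Fin m → ZMod 3) :
    ∑ x : Fin m → ZMod 3, (chi (dotp w x)).re = if w = 0 then 3 ^ m else 0 := by
  split_ifs with h
  · simp [h, dotp_zero_left, chi_re, ZMod.card]
  · exact sum_chi_re_dotp h

/-- The character sum of `w` over the support of `F` (real part). -/
noncomputable def suppSum {m : ℕ} (F : (Fin m → ZMod 3) → ZMod 3) (w : Fin m → ZMod 3) : ℝ :=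
  ∑ x with F x ≠ 0, (chi (dotp w x)).re

lemma walsh_re {m : ℕ} {F : (Fin m → ZMod 3) → ZMod 3} (hF : ∀ x, F (-x) = F x)
    (w : Fin m → ZMod 3) :
    (walsh F w).re = (if w = 0 then 3 ^ m else 0) - 3 / 2 * suppSum F w := by
  have h1 : (walsh F w).re = ∑ x, (chi (F x - dotp w x)).re := by
    simp [walsh]
  have h2 : (walsh F w).re = ∑ x, (chi (F x + dotp w x)).re := by
    rw [h1, ← Equiv.sum_comp (Equiv.neg _)]
    simp [hF, dotp_neg_right]
  have h3 : 2 * (walsh F w).re = 2 * ∑ x, (chi (F x)).re * (chi (dotp w x)).re := by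
    rw [two_mul]
    nth_rewrite 1 [h1]
    rw [h2, ← Finset.sum_add_distrib, Finset.mul_sum]
    exact Finset.sum_congr rfl fun x _ => chi_re_sub_add_chi_re_add _ _
  rw [← sum_chi_re_dotp_eq_ite, suppSum, Finset.sum_filter, Finset.mul_sum,
    ← Finset.sum_sub_distrib, mul_left_cancel₀ two_ne_zero h3]
  refine Finset.sum_congr rfl fun x _ => ?_
  rw [chi_re (F x)]
  by_cases h : F x = 0 <;> simp [h]
  ring

lemma suppSum_neg {m : ℕ} (F : (Fin m → ZMod 3) → ZMod 3) (w : Fin m → ZMod 3) :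
    suppSum F (-w) = suppSum F w := by
  simp [suppSum, dotp_neg_left, chi_re_neg]

lemma suppSum_zero {m : ℕ} (F : (Fin m → ZMod 3) → ZMod 3) :
    suppSum F 0 = #{x | F x ≠ 0} := by
  simp [suppSum, dotp_zero_left, chi_re]

lemma suppSum_le {m : ℕ} (F : (Fin m → ZMod 3) → ZMod 3) (w : Fin m → ZMod 3) :
    suppSum F w ≤ #{x | F x ≠ 0} := by
  rw [← suppSum_zero, suppSum, suppSum]
  refine Finset.sum_le_sum fun x _ => ?_
  rw [dotp_zero_left, chi_re, chi_re]
  split_ifs <;> norm_num at *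

lemma le_suppSum {m : ℕ} (F : (Fin m → ZMod 3) → ZMod 3) (w : Fin m → ZMod 3) :
    -(#{x | F x ≠ 0} : ℝ) / 2 ≤ suppSum F w := by
  have h : ∑ x with F x ≠ 0, (-1 / 2 : ℝ) ≤ suppSum F w := by
    refine Finset.sum_le_sum fun x _ => ?_
    rw [chi_re]
    split_ifs <;> norm_num
  rw [Finset.sum_const, nsmul_eq_mul] at h
  linarith

lemma suppSum_lt {m : ℕ} {F : (Fin m → ZMod 3) → ZMod 3} {w : Fin m → ZMod 3}
    (h : ∃ x, F x ≠ 0 ∧ dotp w x ≠ 0) : suppSum F w < #{x | F x ≠ 0} := by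
  obtain ⟨x, hx, hwx⟩ := h
  rw [← suppSum_zero, suppSum, suppSum]
  refine Finset.sum_lt_sum (fun y _ => ?_) ⟨x, by simpa using hx, ?_⟩
  · rw [dotp_zero_left, chi_re, chi_re]
    split_ifs <;> norm_num at *
  · rw [dotp_zero_left, chi_re, chi_re, if_neg hwx]
    norm_num

/-- The required non-equality for any even function with small support, on which every nonzero
linear form is not identically zero. -/
lemma walsh_re_combination_ne {m : ℕ} {F : (Fin m → ZMod 3) → ZMod 3}
    (hF : ∀ x, F (-x) = F x) (hcard : 9 * #{x | F x ≠ 0} < 2 * 3 ^ m)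
    (hex : ∀ w : Fin m → ZMod 3, w ≠ 0 → ∃ x, F x ≠ 0 ∧ dotp w x ≠ 0)
    {v₁ v₂ v₃ : Fin m → ZMod 3} (h12 : v₁ ≠ v₂) (h13 : v₁ ≠ v₃) (h23 : v₂ ≠ v₃)
    (hsum : v₁ + v₂ + v₃ = 0) :
    (walsh F v₁).re + (walsh F v₂).re - 2 * (walsh F v₃).re ≠ 3 ^ m := by
  have hcard' : 9 * (#{x | F x ≠ 0} : ℝ) < 2 * 3 ^ m := by exact_mod_cast hcard
  rw [walsh_re hF, walsh_re hF, walsh_re hF]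
  have l₁ := le_suppSum F v₁
  have l₂ := le_suppSum F v₂
  have u₃ := suppSum_le F v₃
  intro h
  by_cases h1 : v₁ = 0
  · subst h1
    have e : v₂ = -v₃ := eq_neg_of_add_eq_zero_left (by simpa using hsum)
    rw [if_pos rfl, if_neg h12.symm, if_neg h13.symm, e, suppSum_neg, suppSum_zero] at h
    have := suppSum_lt (hex v₃ h13.symm)
    linarith
  by_cases h2 : v₂ = 0
  · subst h2
    have e : v₁ = -v₃ := eq_neg_of_add_eq_zero_left (by simpa using hsum)
    rw [if_pos rfl, if_neg h12, if_neg h23.symm, e, suppSum_neg, suppSum_zero] at h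
    have := suppSum_lt (hex v₃ h23.symm)
    linarith
  rw [if_neg h1, if_neg h2] at h
  have hpos : (0 : ℝ) < 3 ^ m := by positivity
  split_ifs at h <;> linarith

open Polynomial in
/-- The number of ternary vectors of length `m` and weight `j`. -/
lemma card_hammingNorm_eq (m j : ℕ) :
    #{x : Fin m → ZMod 3 | hammingNorm x = j} = m.choose j * 2 ^ j := by
  have h : ∑ x : Fin m → ZMod 3, (X : ℕ[X]) ^ hammingNorm x = (1 + C 2 * X) ^ m := by
    have hfac : ∑ a : ZMod 3, (if a ≠ 0 then X else 1 : ℕ[X]) = 1 + C 2 * X := by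
      have huniv : (univ : Finset (ZMod 3)) = {0, 1, 2} := by decide
      rw [huniv]
      simp (decide := true)
      ring
    calc ∑ x : Fin m → ZMod 3, (X : ℕ[X]) ^ hammingNorm x
        = ∑ x : Fin m → ZMod 3, ∏ i, (if x i ≠ 0 then X else 1 : ℕ[X]) := by
          refine Finset.sum_congr rfl fun x _ => ?_
          rw [Finset.prod_ite, Finset.prod_const, Finset.prod_const_one, mul_one, hammingNorm]
      _ = ∏ _i : Fin m, ∑ a : ZMod 3, (if a ≠ 0 then X else 1 : ℕ[X]) := by
          rw [Finset.prod_univ_sum, Fintype.piFinset_univ]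
      _ = (1 + C 2 * X) ^ m := by rw [hfac, Finset.prod_const, Finset.card_univ, Fintype.card_fin]
  have hc := congrArg (fun p => coeff p j) h
  simp only [finsetSum_coeff, coeff_X_pow] at hc
  rw [Finset.card_filter]
  simp_rw [eq_comm (b := j), hc]
  have hcomp : (1 + C 2 * X : ℕ[X]) ^ m = ((1 + X) ^ m).comp (C 2 * X) := by simp
  rw [hcomp, comp_C_mul_X_coeff, coeff_one_add_X_pow]
  simp

/-- The size of the ternary Hamming ball of radius `k` in dimension `m`. -/
def ballCard (m k : ℕ) : ℕ := ∑ j ∈ range (k + 1), m.choose j * 2 ^ j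

lemma card_hammingNorm_le (m k : ℕ) :
    #{x : Fin m → ZMod 3 | hammingNorm x ≤ k} = ballCard m k := by
  rw [ballCard, Finset.card_eq_sum_card_fiberwise (f := hammingNorm) (t := range (k + 1))]
  · refine Finset.sum_congr rfl fun j hj => ?_
    rw [← card_hammingNorm_eq, Finset.filter_filter]
    congr 1
    ext x
    simp only [mem_range] at hj
    simp only [mem_filter, mem_univ, true_and]
    omega
  · intro x hx
    simp only [coe_filter, mem_univ, true_and, Set.mem_ofPred_eq] at hx
    simp only [coe_range, Set.mem_Iio]
    omega

lemma ballCard_succ_right (m k : ℕ) :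
    ballCard m (k + 1) = ballCard m k + m.choose (k + 1) * 2 ^ (k + 1) :=
  Finset.sum_range_succ _ _

lemma ballCard_succ_succ (m k : ℕ) :
    ballCard (m + 1) (k + 1) = ballCard m (k + 1) + 2 * ballCard m k := by
  induction k with
  | zero => simp [ballCard, Finset.sum_range_succ]; ring
  | succ k ih =>
    rw [ballCard_succ_right (m + 1), ih, ballCard_succ_right m (k + 1), ballCard_succ_right m k,
      Nat.choose_succ_succ]
    ring

lemma ballCard_odd_bound (n : ℕ) (hn : 4 ≤ n) :
    9 * ballCard (2 * n + 1) n < 2 * 3 ^ (2 * n + 1) := by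
  induction n, hn using Nat.le_induction with
  | base => norm_num [ballCard, Finset.sum_range_succ, Nat.choose]
  | succ n hn ih =>
    obtain ⟨l, rfl⟩ : ∃ l, n = l + 1 := ⟨n - 1, by omega⟩
    have e1 : 2 * (l + 1 + 1) + 1 = 2 * (l + 1) + 1 + 1 + 1 := by ring
    have hs : (2 * (l + 1) + 1).choose (l + 1 + 1) = (2 * (l + 1) + 1).choose (l + 1) :=
      Nat.choose_symm_half (l + 1)
    have a1 := ballCard_succ_succ (2 * (l + 1) + 1 + 1) (l + 1)
    have a2 := ballCard_succ_succ (2 * (l + 1) + 1) (l + 1)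
    have a3 := ballCard_succ_succ (2 * (l + 1) + 1) l
    have a4 := ballCard_succ_right (2 * (l + 1) + 1) (l + 1)
    have a5 := ballCard_succ_right (2 * (l + 1) + 1) l
    rw [hs, pow_succ 2 (l + 1)] at a4
    rw [e1, pow_succ, pow_succ]
    generalize (2 * (l + 1) + 1).choose (l + 1) = c at *
    generalize 2 ^ (l + 1) = d at *
    have : c * (d * 2) = 2 * (c * d) := by ring
    omega

lemma ballCard_bound {m : ℕ} (hm : 9 ≤ m) : 9 * ballCard m ((m - 1) / 2) < 2 * 3 ^ m := by
  rcases Nat.even_or_odd' m with ⟨n, rfl | rfl⟩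
  · obtain ⟨l, rfl⟩ : ∃ l, n = l + 2 := ⟨n - 2, by omega⟩
    have h := ballCard_odd_bound (l + 1) (by omega)
    have a := ballCard_succ_succ (2 * (l + 1) + 1) l
    have b := ballCard_succ_right (2 * (l + 1) + 1) l
    have e1 : (2 * (l + 2) - 1) / 2 = l + 1 := by omega
    have e2 : 2 * (l + 2) = 2 * (l + 1) + 1 + 1 := by ring
    rw [e1, e2, pow_succ]
    omega
  · have e : (2 * n + 1 - 1) / 2 = n := by omega
    rw [e]
    exact ballCard_odd_bound n (by omega)

lemma hammingNorm_neg_ternary {m : ℕ} (x : Fin m → ZMod 3) :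
    hammingNorm (-x) = hammingNorm x := by
  simp [hammingNorm]

/-- The required non-equality for functions of the weight supported in weights at most
`(m - 1) / 2`, and nonzero on some whole positive weight class. -/
lemma walsh_re_combination_ne_of_weight {m t : ℕ} (hm : 9 ≤ m)
    {F : (Fin m → ZMod 3) → ZMod 3} (φ : ℕ → ZMod 3) (hF : ∀ x, F x = φ (hammingNorm x))
    (hφ : ∀ j, φ j ≠ 0 → j ≤ (m - 1) / 2) (ht : 1 ≤ t) (hφt : φ t ≠ 0)
    {v₁ v₂ v₃ : Fin m → ZMod 3} (h12 : v₁ ≠ v₂) (h13 : v₁ ≠ v₃) (h23 : v₂ ≠ v₃)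
    (hsum : v₁ + v₂ + v₃ = 0) :
    (walsh F v₁).re + (walsh F v₂).re - 2 * (walsh F v₃).re ≠ 3 ^ m := by
  refine walsh_re_combination_ne (fun x => ?_) ?_ (fun w hw => ?_) h12 h13 h23 hsum
  · rw [hF, hF, hammingNorm_neg_ternary]
  · refine lt_of_le_of_lt (Nat.mul_le_mul_left 9 ?_) (ballCard_bound hm)
    rw [← card_hammingNorm_le]
    refine Finset.card_le_card fun x hx => ?_
    simp only [mem_filter, mem_univ, true_and, hF] at hx ⊢
    exact hφ _ hx
  · have htm : t ≤ m := (hφ t hφt).trans (by omega)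
    obtain ⟨x, hx, hwx⟩ := exists_hammingNorm_eq_dotp_ne_zero ht htm hw
    exact ⟨x, by rwa [hF, hx], hwx⟩

theorem stmt12 (m k₁ k₂ : ℕ) (hm : 9 ≤ m) (hk₁ : 2 ≤ k₁) (hk : k₁ + 1 < k₂)
    (hk₂ : k₂ ≤ (m - 1) / 2) :
    ∀ F ∈ ({ffun m k₁ k₂, gfun m k₁ k₂, ffun m k₁ k₂ + gfun m k₁ k₂,
        ffun m k₁ k₂ - gfun m k₁ k₂} : Set ((Fin m → ZMod 3) → ZMod 3)),
      ∀ v₁ v₂ v₃ : Fin m → ZMod 3,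
        v₁ ≠ v₂ → v₁ ≠ v₃ → v₂ ≠ v₃ → v₁ + v₂ + v₃ = 0 →
        (walsh F v₁).re + (walsh F v₂).re - 2 * (walsh F v₃).re ≠ 3 ^ m := by
  intro F hF v₁ v₂ v₃ h12 h13 h23 hsum
  let φ : ℕ → ZMod 3 := fun j => if 1 ≤ j ∧ j ≤ k₂ ∧ j ≠ k₁ then 1 else 0
  let ψ : ℕ → ZMod 3 := fun j => if k₁ ≤ j ∧ j ≤ k₂ - 1 then 1 else if j = k₂ then -1 else 0
  have hφ (j : ℕ) (hj : k₂ < j) : φ j = 0 := if_neg (by omega)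
  have hψ (j : ℕ) (hj : k₂ < j) : ψ j = 0 := by
    simp only [ψ]
    rw [if_neg (by omega), if_neg (by omega)]
  have hφk₁ : φ k₁ = 0 := if_neg (by omega)
  have hψk₁ : ψ k₁ = 1 := if_pos (by omega)
  have hφk₂ : φ k₂ = 1 := if_pos (by omega)
  simp only [Set.mem_insert_iff, Set.mem_singleton_iff] at hF
  rcases hF with rfl | rfl | rfl | rfl
  · refine walsh_re_combination_ne_of_weight (t := k₂) hm φ (fun x => rfl) (fun j hj => ?_)
      (by omega) (by rw [hφk₂]; decide) h12 h13 h23 hsum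
    by_contra! hlt
    exact hj (hφ j (by omega))
  · refine walsh_re_combination_ne_of_weight (t := k₁) hm ψ (fun x => rfl) (fun j hj => ?_)
      (by omega) (by rw [hψk₁]; decide) h12 h13 h23 hsum
    by_contra! hlt
    exact hj (hψ j (by omega))
  · refine walsh_re_combination_ne_of_weight (t := k₁) hm (φ + ψ) (fun x => rfl)
      (fun j hj => ?_) (by omega) (by rw [Pi.add_apply, hφk₁, hψk₁]; decide) h12 h13 h23 hsum
    by_contra! hlt
    exact hj (by rw [Pi.add_apply, hφ j (by omega), hψ j (by omega), add_zero])
  · refine walsh_re_combination_ne_of_weight (t := k₁) hm (φ - ψ) (fun x => rfl)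
      (fun j hj => ?_) (by omega) (by rw [Pi.sub_apply, hφk₁, hψk₁]; decide) h12 h13 h23 hsum
    by_contra! hlt
    exact hj (by rw [Pi.sub_apply, hφ j (by omega), hψ j (by omega), sub_zero])
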